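/- Let (I, (F_i^#), (F_i), (τ_i), (a_i), (c_i), W, q_W, X_W) and (I', (F'^#_{i'}), (F'_{i'}), (τ'_{i'}), (a'_{i'}), (c'_{i'}), W', q_{W'}, X_{W'}) be two instances of the data described in the context. Then the characteristic polynomials of X_W and of X_{W'} are equal if and only if there exist a bijection φ : I → I' and, for each i ∈ I, an F-algebra isomorphism σ_i : F'_{φ(i)} → F_i with σ_i(a'_{φ(i)}) = a_i. -/

import Mathlib

open scoped TensorProduct

/-- One factor `F_i` of the data in the context: a finite field extension `Fs = F_i^#` of
`F`, an étale quadratic `Fs`-algebra `A = F_i` (reduced and free of rank 2 over `Fs`,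
hence either a quadratic field extension of `Fs` or `Fs × Fs`), the nontrivial
`Fs`-algebra involution `τ` with fixed subalgebra `Fs`, and units `a, c ∈ A` with
`τ a = −a`, `τ c = c` and `a` generating `A` as an `F`-algebra. -/
structure QuadDatum (F : Type*) [Field F] where
  Fs : Type*
  [fieldFs : Field Fs]
  [algFFs : Algebra F Fs]
  [finFFs : FiniteDimensional F Fs]
  A : Type*
  [ringA : CommRing A]
  [algFA : Algebra F A]
  [algFsA : Algebra Fs A]
  [towerA : IsScalarTower F Fs A]
  [redA : IsReduced A]
  [finFA : Module.Finite F A]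
  [freeFsA : Module.Free Fs A]
  rank_two : Module.finrank Fs A = 2
  τ : A ≃ₐ[Fs] A
  τ_ne : τ ≠ AlgEquiv.refl
  τ_invol : ∀ x : A, τ (τ x) = x
  τ_fixed : ∀ x : A, τ x = x ↔ x ∈ (algebraMap Fs A).range
  a : A
  a_unit : IsUnit a
  τ_a : τ a = -a
  a_gen : Algebra.adjoin F {a} = ⊤
  c : A
  c_unit : IsUnit c
  τ_c : τ c = c

attribute [instance] QuadDatum.fieldFs QuadDatum.algFFs QuadDatum.finFFs QuadDatum.ringA
  QuadDatum.algFA QuadDatum.algFsA QuadDatum.towerA QuadDatum.redA QuadDatum.finFA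
  QuadDatum.freeFsA

open Polynomial

/-- The characteristic polynomial of a diagonal endomorphism of a finite product of modules is the
product of the characteristic polynomials of its components. -/
theorem LinearMap.charpoly_eq_prod_of_apply_apply {R ι : Type*} [Field R] [Fintype ι]
    {M : ι → Type*} [∀ i, AddCommGroup (M i)] [∀ i, Module R (M i)] [∀ i, Module.Finite R (M i)]
    (g : ∀ i, Module.End R (M i)) (f : Module.End R (∀ i, M i))
    (hf : ∀ v i, f v i = g i (v i)) : f.charpoly = ∏ i, (g i).charpoly := by
  refine Fintype.induction_empty_option (P := fun ι _ ↦ ∀ (M : ι → Type _)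
    [∀ i, AddCommGroup (M i)] [∀ i, Module R (M i)] [∀ i, Module.Finite R (M i)]
    (g : ∀ i, Module.End R (M i)) (f : Module.End R (∀ i, M i)) (_ : ∀ v i, f v i = g i (v i)),
    f.charpoly = ∏ i, (g i).charpoly) ?_ ?_ ?_ ι M g f hf
  · intro α β _ e ih M _ _ _ g f hf
    let := Fintype.ofEquiv β e.symm
    rw [← Equiv.prod_comp e, ← ih (fun i ↦ M (e i)) (fun i ↦ g (e i))
      ((LinearEquiv.piCongrLeft R M e).symm.conj f) (fun v i ↦ ?_), LinearEquiv.charpoly_conj]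
    rw [LinearEquiv.conj_apply_apply]
    change f _ (e i) = _
    rw [hf]
    congr 1
    exact congr_fun ((LinearEquiv.piCongrLeft R M e).symm_apply_apply v) i
  · intro M _ _ _ g f _
    rw [Finset.univ_eq_empty, Finset.prod_empty, ← f.charpoly_monic.natDegree_eq_zero,
      f.charpoly_natDegree, Module.finrank_zero_of_subsingleton]
  · intro α _ ih M _ _ _ g f hf
    let h : Module.End R (∀ i : α, M (some i)) :=
      LinearMap.pi fun i ↦ g (some i) ∘ₗ LinearMap.proj i
    rw [Fintype.prod_option, ← ih _ (fun i ↦ g (some i)) h (fun v i ↦ rfl),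
      ← LinearMap.charpoly_prodMap, ← LinearEquiv.charpoly_conj (LinearEquiv.piOptionEquivProd R) f]
    congr 1
    refine LinearMap.ext fun v ↦ Prod.ext ?_ (funext fun i ↦ ?_)
    · exact hf _ none
    · exact hf _ (some i)

/-- Multiplication by a generator has the minimal polynomial of the generator as its
characteristic polynomial. -/
theorem Algebra.charpoly_mulLeft_of_adjoin_eq_top {K A : Type*} [Field K] [CommRing A] [Algebra K A]
    [Module.Finite K A] {a : A} (ha : Algebra.adjoin K {a} = ⊤) :
    (LinearMap.mulLeft K a).charpoly = minpoly K a := by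
  let pb := (IsAdjoinRootMonic.mkOfAdjoinEqTop' ha).powerBasis
  have hgen : pb.gen = a := IsAdjoinRootMonic.mkOfAdjoinEqTop'_root ha
  rw [← LinearMap.charpoly_toMatrix _ pb.basis]
  conv_rhs => rw [← hgen, ← charpoly_leftMulMatrix pb, hgen]
  rfl

/-- Two algebras generated by elements with the same minimal polynomial are isomorphic over these
generators. -/
theorem minpoly.exists_algEquiv_of_eq {K A B : Type*} [Field K] [CommRing A] [Algebra K A]
    [Module.Finite K A] [CommRing B] [Algebra K B] [Module.Finite K B] {a : A} {b : B}
    (ha : Algebra.adjoin K {a} = ⊤) (hb : Algebra.adjoin K {b} = ⊤)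
    (h : minpoly K a = minpoly K b) : ∃ e : A ≃ₐ[K] B, e a = b := by
  let pa := (IsAdjoinRootMonic.mkOfAdjoinEqTop' ha).powerBasis
  let pb := (IsAdjoinRootMonic.mkOfAdjoinEqTop' hb).powerBasis
  have hga : pa.gen = a := IsAdjoinRootMonic.mkOfAdjoinEqTop'_root ha
  have hgb : pb.gen = b := IsAdjoinRootMonic.mkOfAdjoinEqTop'_root hb
  have h' : minpoly K pa.gen = minpoly K pb.gen := by rw [hga, hgb, h]
  have key := pa.equivOfMinpoly_gen pb h'
  rw [hgb] at key
  exact ⟨pa.equivOfMinpoly pb h', (congrArg _ hga.symm).trans key⟩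

namespace QuadDatum

variable {F : Type*} [Field F] (D : QuadDatum F)

theorem nontrivial_A : Nontrivial D.A :=
  Module.nontrivial_of_finrank_pos (R := D.Fs) (by rw [D.rank_two]; exact two_pos)

theorem isIntegral_a : IsIntegral F D.a := Algebra.IsIntegral.isIntegral _

theorem τ_aeval (p : F[X]) : D.τ (aeval D.a p) = aeval D.a (p.comp (-X)) := by
  have h := aeval_algHom_apply (D.τ.restrictScalars F : D.A →ₐ[F] D.A) D.a p
  rw [aeval_comp, map_neg, aeval_X, ← D.τ_a]
  exact h.symm

theorem minpoly_dvd_minpoly_comp_neg_X : minpoly F D.a ∣ (minpoly F D.a).comp (-X) := by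
  rw [minpoly.dvd_iff, ← τ_aeval, minpoly.aeval, map_zero]

theorem comp_neg_X_dvd_minpoly {m : F[X]} (hm : m ∣ minpoly F D.a) :
    m.comp (-X) ∣ minpoly F D.a := by
  obtain ⟨r, hr⟩ := hm.trans D.minpoly_dvd_minpoly_comp_neg_X
  have h := congrArg (fun p ↦ p.comp (-X)) hr
  simp only [comp_assoc, neg_comp, X_comp, neg_neg, comp_X, mul_comp] at h
  exact ⟨_, h⟩

theorem minpoly_dvd_mul_comp_neg_X {m : F[X]} (hm : m ∣ minpoly F D.a) (hu : ¬IsUnit m) :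
    minpoly F D.a ∣ m * m.comp (-X) := by
  rw [minpoly.dvd_iff, map_mul, ← τ_aeval]
  set x := aeval D.a m with hx
  obtain ⟨y, hy⟩ := (D.τ_fixed (x * D.τ x)).1 (by rw [map_mul, D.τ_invol, mul_comm])
  by_contra h0
  have hy0 : y ≠ 0 := by rintro rfl; exact h0 (by rw [← hy, map_zero])
  have hxu : IsUnit x :=
    isUnit_of_mul_isUnit_left (hy ▸ (IsUnit.mk0 y hy0).map (algebraMap D.Fs D.A))
  obtain ⟨r, hr⟩ := hm
  have hr0 : aeval D.a r = 0 := by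
    have := minpoly.aeval F D.a
    rwa [hr, map_mul, ← hx, hxu.mul_right_eq_zero] at this
  have hdvd : m * r ∣ 1 * r := by rw [← hr, one_mul]; exact minpoly.dvd F D.a hr0
  have hr_ne : r ≠ 0 := by
    rintro rfl
    exact minpoly.ne_zero D.isIntegral_a (by rw [hr, mul_zero])
  exact hu (isUnit_of_dvd_one ((mul_dvd_mul_iff_right hr_ne).1 hdvd))

variable {D} {E : QuadDatum F}

theorem minpoly_dvd_of_common_factor {m : F[X]} (hu : ¬IsUnit m) (hD : m ∣ minpoly F D.a)
    (hE : m ∣ minpoly F E.a) : minpoly F D.a ∣ minpoly F E.a :=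
  minpoly.isRadical F D.a 2 _ <| (D.minpoly_dvd_mul_comp_neg_X hD hu).trans <| by
    rw [sq]
    exact mul_dvd_mul hE (E.comp_neg_X_dvd_minpoly hE)

theorem minpoly_eq_of_common_factor {m : F[X]} (hu : ¬IsUnit m) (hD : m ∣ minpoly F D.a)
    (hE : m ∣ minpoly F E.a) : minpoly F D.a = minpoly F E.a :=
  eq_of_monic_of_associated (minpoly.monic D.isIntegral_a) (minpoly.monic E.isIntegral_a)
    (associated_of_dvd_dvd (minpoly_dvd_of_common_factor hu hD hE)
      (minpoly_dvd_of_common_factor hu hE hD))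

theorem exists_minpoly_eq_of_dvd_prod {ι : Type*} [Fintype ι] {E : ι → QuadDatum F}
    (h : minpoly F D.a ∣ ∏ i, minpoly F (E i).a) : ∃ i, minpoly F D.a = minpoly F (E i).a := by
  have := D.nontrivial_A
  obtain ⟨m, hm, hmD⟩ := WfDvdMonoid.exists_irreducible_factor (minpoly.not_isUnit F D.a)
    (minpoly.ne_zero D.isIntegral_a)
  obtain ⟨i, -, hi⟩ := (hm.prime.dvd_finsetProd_iff _).1 (hmD.trans h)
  exact ⟨i, minpoly_eq_of_common_factor hm.not_isUnit hmD hi⟩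

theorem charpoly_eq_prod_minpoly {ι : Type*} [Fintype ι] (E : ι → QuadDatum F)
    (f : Module.End F (∀ i, (E i).A)) (hf : ∀ v i, f v i = (E i).a * v i) :
    f.charpoly = ∏ i, minpoly F (E i).a := by
  rw [LinearMap.charpoly_eq_prod_of_apply_apply (fun i ↦ LinearMap.mulLeft F (E i).a) f hf]
  exact Finset.prod_congr rfl fun i _ ↦ Algebra.charpoly_mulLeft_of_adjoin_eq_top (E i).a_gen

theorem minpoly_injective {ι : Type*} {E : ι → QuadDatum F}
    (h : ∀ i j : ι, i ≠ j → ∀ e : (E i).A ≃ₐ[F] (E j).A, e (E i).a ≠ (E j).a) :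
    Function.Injective fun i ↦ minpoly F (E i).a := fun i j hij ↦ by
  by_contra hne
  obtain ⟨e, he⟩ := minpoly.exists_algEquiv_of_eq (E i).a_gen (E j).a_gen hij
  exact h i j hne e he

end QuadDatum

/-- For two instances of the data (with underlying spaces
`W = ⊕_{i∈I} F_i` and `W' = ⊕_{i'∈I'} F'_{i'}` and endomorphisms `X_W`, `X_{W'}` acting
by `a_i`, resp. `a'_{i'}`), the characteristic polynomials of `X_W` and `X_{W'}` are
equal if and only if there are a bijection `φ : I → I'` and, for each `i`, an `F`-algebra
isomorphism `σ_i : F'_{φ(i)} → F_i` with `σ_i(a'_{φ(i)}) = a_i`. -/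
theorem stmt_10 (F : Type*) [Field F] [CharZero F]
    (I : Type*) [Fintype I] (D : I → QuadDatum F)
    (hdist : ∀ i j : I, i ≠ j → ∀ e : (D i).A ≃ₐ[F] (D j).A, e (D i).a ≠ (D j).a)
    (I' : Type*) [Fintype I'] (D' : I' → QuadDatum F)
    (hdist' : ∀ i j : I', i ≠ j → ∀ e : (D' i).A ≃ₐ[F] (D' j).A, e (D' i).a ≠ (D' j).a)
    (XW : Module.End F (∀ i, (D i).A))
    (hXW : ∀ (v : ∀ i, (D i).A) (i : I), XW v i = (D i).a * v i)
    (XW' : Module.End F (∀ i', (D' i').A))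
    (hXW' : ∀ (v : ∀ i', (D' i').A) (i' : I'), XW' v i' = (D' i').a * v i') :
    LinearMap.charpoly XW = LinearMap.charpoly XW' ↔
      ∃ φ : I ≃ I', ∀ i : I,
        ∃ e : (D' (φ i)).A ≃ₐ[F] (D i).A, e (D' (φ i)).a = (D i).a := by
  rw [QuadDatum.charpoly_eq_prod_minpoly D XW hXW, QuadDatum.charpoly_eq_prod_minpoly D' XW' hXW']
  constructor
  · intro h
    have hφ (i : I) : ∃ j, minpoly F (D i).a = minpoly F (D' j).a :=
      QuadDatum.exists_minpoly_eq_of_dvd_prod (h ▸ Finset.dvd_prod_of_mem _ (Finset.mem_univ i))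
    have hψ (j : I') : ∃ i, minpoly F (D' j).a = minpoly F (D i).a :=
      QuadDatum.exists_minpoly_eq_of_dvd_prod (h ▸ Finset.dvd_prod_of_mem _ (Finset.mem_univ j))
    choose φ hφ using hφ
    choose ψ hψ using hψ
    refine ⟨⟨φ, ψ, fun i ↦ ?_, fun j ↦ ?_⟩, fun i ↦ ?_⟩
    · exact QuadDatum.minpoly_injective hdist ((hφ i).trans (hψ (φ i))).symm
    · exact QuadDatum.minpoly_injective hdist' ((hψ j).trans (hφ (ψ j))).symm
    · exact minpoly.exists_algEquiv_of_eq (D' (φ i)).a_gen (D i).a_gen (hφ i).symm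
  · rintro ⟨φ, hφ⟩
    rw [← Equiv.prod_comp φ]
    refine Finset.prod_congr rfl fun i _ ↦ ?_
    obtain ⟨e, he⟩ := hφ i
    rw [← he, minpoly.algEquiv_eq]
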